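/- Let n ≥ 1 and j ∈ {1,…,n}. There exist constants C > 0 and c > 0 such that for all x, y ∈ ℝⁿ with x ≠ y, the Hermite Riesz transform kernel R_j(x,y) := π^{-1/2} ∫_0^∞ t^{-1} Ω_j(x,y,t) dt is well defined (the integral converges absolutely) and satisfies |R_j(x,y)| ≤ C e^{-c(|x-y|² + |y| |x-y|)} / |x-y|^n. -/

import Mathlib

open Real MeasureTheory Set

/-- The Mehler (Hermite heat) kernel on ℝⁿ. -/
noncomputable def W (n : ℕ) (s : ℝ) (x y : EuclideanSpace ℝ (Fin n)) : ℝ :=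
  (Real.exp (-2 * s) / (Real.pi * (1 - Real.exp (-4 * s)))) ^ ((n : ℝ) / 2) *
    Real.exp (-(1 / 4) * ((1 + Real.exp (-2 * s)) / (1 - Real.exp (-2 * s)) * ‖x - y‖ ^ 2 +
      (1 - Real.exp (-2 * s)) / (1 + Real.exp (-2 * s)) * ‖x + y‖ ^ 2))

/-- A_{j,s}(x,y) = (∂_{x_j} + x_j) W_s(x,y). -/
noncomputable def A (n : ℕ) (j : Fin n) (s : ℝ) (x y : EuclideanSpace ℝ (Fin n)) : ℝ :=
  (x j - 1 / 2 * ((1 + Real.exp (-2 * s)) / (1 - Real.exp (-2 * s))) * (x j - y j) -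
    1 / 2 * ((1 - Real.exp (-2 * s)) / (1 + Real.exp (-2 * s))) * (x j + y j)) * W n s x y

/-- Ω_j(x,y,t) = t (∂_{x_j} + x_j) P_t^L(x,y), where P_t^L is the Hermite-Poisson kernel. -/
noncomputable def Omj (n : ℕ) (j : Fin n) (x y : EuclideanSpace ℝ (Fin n)) (t : ℝ) : ℝ :=
  t ^ 2 / Real.sqrt (4 * Real.pi) *
    ∫ s in Set.Ioi (0 : ℝ), s ^ (-(3 : ℝ) / 2) * Real.exp (-t ^ 2 / (4 * s)) * A n j s x y

/-- The power of the time variable produced by the Mehler prefactor, after one factor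
`tanh s ^ (-1/2)` has been absorbed. -/
lemma mehler_prefactor_mul_le {n : ℕ} (hn : 1 ≤ n) {s : ℝ} (hs : 0 < s) :
    (exp (-2 * s) / (π * (1 - exp (-4 * s)))) ^ ((n : ℝ) / 2) *
      ((1 - exp (-2 * s)) / (1 + exp (-2 * s))) ^ (-(1 : ℝ) / 2) ≤
        s ^ (-((n : ℝ) + 1) / 2) := by
  have hp : 0 < exp (-s) := exp_pos _
  have hmul : exp s * exp (-s) = 1 := by rw [← exp_add]; simp
  have hsinh : s ≤ sinh s := self_le_sinh_iff.2 hs.le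
  have hcosh : 1 ≤ cosh s := one_le_cosh s
  have h2 : exp (-2 * s) = exp (-s) ^ 2 := by rw [← exp_nat_mul]; congr 1; push_cast; ring
  have h4 : exp (-4 * s) = exp (-s) ^ 4 := by rw [← exp_nat_mul]; congr 1; push_cast; ring
  have hs' : 1 - exp (-s) ^ 2 = 2 * exp (-s) * sinh s := by
    rw [sinh_eq]; linear_combination -hmul
  have hc' : 1 + exp (-s) ^ 2 = 2 * exp (-s) * cosh s := by
    rw [cosh_eq]; linear_combination -hmul
  have hsp : 0 < sinh s := hs.trans_le hsinh
  have hcp : 0 < cosh s := cosh_pos s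
  have hD : exp (-2 * s) / (π * (1 - exp (-4 * s))) = 1 / (4 * π * (sinh s * cosh s)) := by
    rw [h2, h4, show 1 - exp (-s) ^ 4 = (1 - exp (-s) ^ 2) * (1 + exp (-s) ^ 2) by ring, hs', hc']
    field_simp
    norm_num
  have hu : (1 - exp (-2 * s)) / (1 + exp (-2 * s)) = sinh s / cosh s := by
    rw [h2, hs', hc']
    field_simp
  rw [hD, hu]
  set D := 1 / (4 * π * (sinh s * cosh s)) with hDdef
  have hDp : 0 < D := by positivity
  have hπ := pi_gt_three
  have hDs : D ≤ s⁻¹ := by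
    rw [hDdef, one_div]
    apply inv_anti₀ hs
    nlinarith [mul_le_mul hsinh hcosh zero_le_one hsp.le]
  have hDu : D / (sinh s / cosh s) ≤ s⁻¹ ^ 2 := by
    rw [hDdef, inv_pow, show 1 / (4 * π * (sinh s * cosh s)) / (sinh s / cosh s)
      = (4 * π * sinh s ^ 2)⁻¹ by field_simp]
    apply inv_anti₀ (by positivity)
    nlinarith [pow_le_pow_left₀ hs.le hsinh 2, sq_nonneg (sinh s)]
  have hn' : (0 : ℝ) ≤ ((n : ℝ) - 1) / 2 := by
    have : (1 : ℝ) ≤ n := by exact_mod_cast hn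
    linarith
  calc D ^ ((n : ℝ) / 2) * (sinh s / cosh s) ^ (-(1 : ℝ) / 2)
      = D ^ (((n : ℝ) - 1) / 2) * (D / (sinh s / cosh s)) ^ ((1 : ℝ) / 2) := by
        rw [div_rpow hDp.le (by positivity), show -(1 : ℝ) / 2 = -(1 / 2) by ring,
          rpow_neg (by positivity), show (n : ℝ) / 2 = ((n : ℝ) - 1) / 2 + 1 / 2 by ring,
          rpow_add hDp]
        ring
    _ ≤ (s⁻¹) ^ (((n : ℝ) - 1) / 2) * (s⁻¹ ^ 2) ^ ((1 : ℝ) / 2) := by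
        gcongr
    _ = s ^ (-((n : ℝ) + 1) / 2) := by
        rw [← sqrt_eq_rpow, sqrt_sq (by positivity), ← rpow_add_one (by positivity),
          inv_rpow hs.le, ← rpow_neg hs.le]
        congr 1
        ring

/-- Pointwise bound for `(∂_{x_j} + x_j) W_s(x,y)`, uniform in all `s > 0`. -/
lemma abs_A_le {n : ℕ} (hn : 1 ≤ n) (j : Fin n) {s : ℝ} (hs : 0 < s)
    (x y : EuclideanSpace ℝ (Fin n)) :
    |A n j s x y| ≤ 4 * exp (-(1 / 64) * (‖x - y‖ ^ 2 + ‖y‖ * ‖x - y‖)) *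
      (s ^ (-((n : ℝ) + 1) / 2) * exp (-(‖x - y‖ ^ 2 / 32) / s)) := by
  have hpre := mehler_prefactor_mul_le hn hs
  have hq : 0 < exp (-2 * s) := exp_pos _
  have hq1 : exp (-2 * s) < 1 := exp_lt_one_iff.2 (by linarith)
  have hqs : 1 - exp (-2 * s) ≤ 2 * s := by linarith [add_one_le_exp (-2 * s)]
  have hinv : (1 + exp (-2 * s)) / (1 - exp (-2 * s)) =
      ((1 - exp (-2 * s)) / (1 + exp (-2 * s)))⁻¹ := (inv_div _ _).symm
  unfold A W
  rw [hinv]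
  have hu0 : 0 < (1 - exp (-2 * s)) / (1 + exp (-2 * s)) := div_pos (by linarith) (by linarith)
  have hu1 : (1 - exp (-2 * s)) / (1 + exp (-2 * s)) ≤ 1 := by
    rw [div_le_one (by linarith)]; linarith
  have hus : (1 - exp (-2 * s)) / (1 + exp (-2 * s)) ≤ 2 * s := by
    rw [div_le_iff₀ (by linarith)]; nlinarith
  have hD : 0 ≤ exp (-2 * s) / (π * (1 - exp (-4 * s))) := by
    have : exp (-4 * s) < 1 := exp_lt_one_iff.2 (by linarith)
    exact div_nonneg hq.le (mul_nonneg pi_pos.le (by linarith))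
  set u := (1 - exp (-2 * s)) / (1 + exp (-2 * s))
  set D := (exp (-2 * s) / (π * (1 - exp (-4 * s)))) ^ ((n : ℝ) / 2)
  have hDn : 0 ≤ D := rpow_nonneg hD _
  have hrj : |x j - y j| ≤ ‖x - y‖ := by simpa using PiLp.norm_apply_le (x - y) j
  have hRj : |x j + y j| ≤ ‖x + y‖ := by simpa using PiLp.norm_apply_le (x + y) j
  have hy : ‖y‖ ≤ (‖x - y‖ + ‖x + y‖) / 2 := by
    have h := norm_sub_le (x + y) (x - y)
    rw [show x + y - (x - y) = (2 : ℝ) • y by rw [two_smul]; abel, norm_smul] at h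
    norm_num at h
    linarith
  have hr0 : 0 ≤ ‖x - y‖ := norm_nonneg _
  have hR0 : 0 ≤ ‖x + y‖ := norm_nonneg _
  set r := ‖x - y‖
  set R := ‖x + y‖
  have hui : 1 ≤ u⁻¹ := (one_le_inv₀ hu0).2 hu1
  have hcoef : |x j - 1 / 2 * u⁻¹ * (x j - y j) - 1 / 2 * u * (x j + y j)| ≤ u⁻¹ * r + R := by
    calc |x j - 1 / 2 * u⁻¹ * (x j - y j) - 1 / 2 * u * (x j + y j)|
        = |(1 - u) / 2 * (x j + y j) - (u⁻¹ - 1) / 2 * (x j - y j)| := by congr 1; ring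
      _ ≤ |(1 - u) / 2 * (x j + y j)| + |(u⁻¹ - 1) / 2 * (x j - y j)| := abs_sub _ _
      _ = (1 - u) / 2 * |x j + y j| + (u⁻¹ - 1) / 2 * |x j - y j| := by
          rw [abs_mul, abs_mul, abs_of_nonneg (by linarith : 0 ≤ (1 - u) / 2),
            abs_of_nonneg (by linarith : 0 ≤ (u⁻¹ - 1) / 2)]
      _ ≤ (1 - u) / 2 * R + (u⁻¹ - 1) / 2 * r := by gcongr
      _ ≤ u⁻¹ * r + R := by
          nlinarith [mul_nonneg hu0.le hR0, mul_nonneg (zero_le_one.trans hui) hr0]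
  set Q := u⁻¹ * r ^ 2 + u * R ^ 2 with hQ
  have hpoly : u⁻¹ * r + R ≤ u ^ (-(1 : ℝ) / 2) * (4 * exp (Q / 8)) := by
    have hw : 0 < √u := sqrt_pos.2 hu0
    have hww : √u ^ 2 = u := sq_sqrt hu0.le
    have hrpow : u ^ (-(1 : ℝ) / 2) = (√u)⁻¹ := by
      rw [sqrt_eq_rpow, ← rpow_neg hu0.le]; norm_num
    have hQ' : Q = (r / √u) ^ 2 + (√u * R) ^ 2 := by
      rw [hQ, div_pow, mul_pow, hww]; ring
    have he := add_one_le_exp (Q / 8)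
    have hsum : u⁻¹ * r + R = (√u)⁻¹ * (r / √u + √u * R) := by
      have : u⁻¹ = (√u)⁻¹ * (√u)⁻¹ := by rw [← mul_inv, mul_self_sqrt hu0.le]
      rw [this]; field_simp
    rw [hrpow, hsum]
    gcongr
    nlinarith [sq_nonneg (r / √u - 1), sq_nonneg (√u * R - 1)]
  have hQs : r ^ 2 / (2 * s) ≤ Q := by
    have : r ^ 2 / (2 * s) ≤ r ^ 2 / u := div_le_div_of_nonneg_left (sq_nonneg r) hu0 hus
    have h2 : 0 ≤ u * R ^ 2 := by positivity
    rw [hQ, inv_mul_eq_div]; linarith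
  have hQr : r ^ 2 ≤ Q := by
    have h2 : 0 ≤ u * R ^ 2 := by positivity
    nlinarith [mul_le_mul_of_nonneg_right hui (sq_nonneg r)]
  have hQR : 2 * (r * R) ≤ Q := by
    have h : 0 ≤ u⁻¹ * (r - u * R) ^ 2 := by positivity
    have h' : u⁻¹ * (r - u * R) ^ 2 = Q - 2 * (r * R) := by
      rw [hQ]; field_simp; ring
    linarith
  have hexp : -(Q / 8) ≤ -(1 / 64) * (r ^ 2 + ‖y‖ * r) + -(r ^ 2 / 32) / s := by
    have h1 : -(r ^ 2 / 32) / s = -(r ^ 2 / (2 * s) / 16) := by ring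
    have h2 := mul_le_mul_of_nonneg_right hy hr0
    rw [h1]
    nlinarith [mul_nonneg hr0 hR0]
  rw [abs_mul, abs_of_nonneg (mul_nonneg hDn (exp_pos _).le)]
  calc |x j - 1 / 2 * u⁻¹ * (x j - y j) - 1 / 2 * u * (x j + y j)| * (D * exp (-(1 / 4) * Q))
      ≤ u ^ (-(1 : ℝ) / 2) * (4 * exp (Q / 8)) * (D * exp (-(1 / 4) * Q)) := by
        gcongr; exact hcoef.trans hpoly
    _ = 4 * (D * u ^ (-(1 : ℝ) / 2)) * exp (-(Q / 8)) := by
        rw [show -(Q / 8) = Q / 8 + -(1 / 4) * Q by ring, exp_add]; ring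
    _ ≤ 4 * s ^ (-((n : ℝ) + 1) / 2) *
          exp (-(1 / 64) * (r ^ 2 + ‖y‖ * r) + -(r ^ 2 / 32) / s) := by
        gcongr
    _ = _ := by rw [exp_add]; ring

/-- The inverse-Gamma integral `∫ s^(-p-1) e^{-b/s} ds = Γ(p) b^(-p)`. -/
lemma integral_rpow_mul_exp_neg_div {p b : ℝ} (hp : 0 < p) (hb : 0 < b) :
    IntegrableOn (fun s : ℝ => s ^ (-p - 1) * exp (-b / s)) (Ioi 0) ∧
      ∫ s in Ioi (0 : ℝ), s ^ (-p - 1) * exp (-b / s) = Gamma p * b ^ (-p) := by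
  have hcongr : EqOn (fun s : ℝ => (|(-1 : ℝ)| * s ^ ((-1 : ℝ) - 1)) •
      ((s ^ (-1 : ℝ)) ^ (p - 1) * exp (-(b * s ^ (-1 : ℝ)))))
      (fun s : ℝ => s ^ (-p - 1) * exp (-b / s)) (Ioi 0) := by
    intro s hs
    have hs' : (0 : ℝ) < s := hs
    simp only [abs_neg, abs_one, one_mul, smul_eq_mul]
    rw [← rpow_mul hs'.le, ← mul_assoc, ← rpow_add hs', rpow_neg_one]
    congr 2 <;> ring
  have hint : IntegrableOn (fun v : ℝ => v ^ (p - 1) * exp (-(b * v))) (Ioi 0) := by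
    simpa using integrableOn_rpow_mul_exp_neg_mul_rpow (p := 1) (by linarith : -1 < p - 1)
      one_pos hb
  constructor
  · rw [← integrableOn_congr_fun hcongr measurableSet_Ioi]
    exact (integrableOn_Ioi_comp_rpow_iff (fun v : ℝ => v ^ (p - 1) * exp (-(b * v)))
      (by norm_num : (-1 : ℝ) ≠ 0)).2 hint
  · rw [← setIntegral_congr_fun measurableSet_Ioi hcongr,
      integral_comp_rpow_Ioi (fun v : ℝ => v ^ (p - 1) * exp (-(b * v))) (by norm_num),
      integral_rpow_mul_exp_neg_mul_Ioi hp hb, one_div, inv_rpow hb.le, ← rpow_neg hb.le, mul_comm]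

lemma integral_mul_sq_add_rpow {q β : ℝ} (hq : 0 < q) (hβ : 0 < β) :
    IntegrableOn (fun t : ℝ => t * (t ^ 2 / 4 + β) ^ (-(q + 1))) (Ioi 0) ∧
      ∫ t in Ioi (0 : ℝ), t * (t ^ 2 / 4 + β) ^ (-(q + 1)) = 2 / q * β ^ (-q) := by
  have hderiv : ∀ t ∈ Ici (0 : ℝ), HasDerivAt (fun t : ℝ => -(2 / q) * (t ^ 2 / 4 + β) ^ (-q))
      (t * (t ^ 2 / 4 + β) ^ (-(q + 1))) t := by
    intro t _
    have hpos : t ^ 2 / 4 + β ≠ 0 := by positivity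
    have h := ((((hasDerivAt_id t).pow 2).div_const 4).add_const β).rpow_const (p := -q)
      (Or.inl hpos)
    convert! h.const_mul (-(2 / q)) using 1
    simp only [id, Pi.pow_apply]
    rw [show -q - 1 = -(q + 1) by ring]
    field_simp
    norm_num
    ring
  have hnonneg : ∀ t ∈ Ioi (0 : ℝ), 0 ≤ t * (t ^ 2 / 4 + β) ^ (-(q + 1)) := by
    intro t ht
    have ht' : (0 : ℝ) < t := ht
    positivity
  have hlim : Filter.Tendsto (fun t : ℝ => -(2 / q) * (t ^ 2 / 4 + β) ^ (-q)) Filter.atTop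
      (nhds 0) := by
    have h1 : Filter.Tendsto (fun t : ℝ => t ^ 2 / 4 + β) Filter.atTop Filter.atTop :=
      Filter.tendsto_atTop_add_const_right _ _
        ((Filter.tendsto_pow_atTop two_ne_zero).atTop_div_const (by norm_num))
    simpa using ((tendsto_rpow_neg_atTop hq).comp h1).const_mul (-(2 / q))
  refine ⟨integrableOn_Ioi_deriv_of_nonneg' hderiv hnonneg hlim, ?_⟩
  rw [integral_Ioi_of_hasDerivAt_of_nonneg' hderiv hnonneg hlim]
  simp

lemma aestronglyMeasurable_Omj_div (n : ℕ) (j : Fin n) (x y : EuclideanSpace ℝ (Fin n))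
    (μ : Measure ℝ) : AEStronglyMeasurable (fun t => Omj n j x y t / t) μ := by
  have h : Measurable (Function.uncurry fun t s : ℝ =>
      s ^ (-(3 : ℝ) / 2) * exp (-t ^ 2 / (4 * s)) * A n j s x y) := by
    unfold A W Function.uncurry
    fun_prop
  have hint : Measurable fun t : ℝ => ∫ s in Ioi (0 : ℝ),
      s ^ (-(3 : ℝ) / 2) * exp (-t ^ 2 / (4 * s)) * A n j s x y :=
    (h.stronglyMeasurable.integral_prod_right).measurable
  unfold Omj
  exact Measurable.aestronglyMeasurable (by fun_prop)

lemma abs_Omj_div_le {n : ℕ} (hn : 1 ≤ n) (j : Fin n) {x y : EuclideanSpace ℝ (Fin n)}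
    (hxy : x ≠ y) {t : ℝ} (ht : 0 < t) :
    |Omj n j x y t / t| ≤ 4 * exp (-(1 / 64) * (‖x - y‖ ^ 2 + ‖y‖ * ‖x - y‖)) *
      Gamma ((n : ℝ) / 2 + 1) *
        (t * (t ^ 2 / 4 + ‖x - y‖ ^ 2 / 32) ^ (-((n : ℝ) / 2 + 1))) := by
  have hr : 0 < ‖x - y‖ := norm_pos_iff.2 (sub_ne_zero.2 hxy)
  have hb : 0 < t ^ 2 / 4 + ‖x - y‖ ^ 2 / 32 := by positivity
  obtain ⟨hint, hval⟩ := integral_rpow_mul_exp_neg_div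
    (by positivity : 0 < (n : ℝ) / 2 + 1) hb
  set K := 4 * exp (-(1 / 64) * (‖x - y‖ ^ 2 + ‖y‖ * ‖x - y‖))
  set b := t ^ 2 / 4 + ‖x - y‖ ^ 2 / 32
  have hI : |∫ s in Ioi (0 : ℝ), s ^ (-(3 : ℝ) / 2) * exp (-t ^ 2 / (4 * s)) * A n j s x y| ≤
      K * (Gamma ((n : ℝ) / 2 + 1) * b ^ (-((n : ℝ) / 2 + 1))) := by
    rw [← hval, ← integral_const_mul, ← Real.norm_eq_abs]
    refine norm_integral_le_of_norm_le (hint.const_mul K) ?_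
    filter_upwards [ae_restrict_mem measurableSet_Ioi] with s hs
    have hs' : (0 : ℝ) < s := hs
    rw [Real.norm_eq_abs, abs_mul, abs_of_pos (by positivity)]
    calc s ^ (-(3 : ℝ) / 2) * exp (-t ^ 2 / (4 * s)) * |A n j s x y|
        ≤ s ^ (-(3 : ℝ) / 2) * exp (-t ^ 2 / (4 * s)) *
          (K * (s ^ (-((n : ℝ) + 1) / 2) * exp (-(‖x - y‖ ^ 2 / 32) / s))) := by
          gcongr
          exact abs_A_le hn j hs' x y
      _ = K * ((s ^ (-(3 : ℝ) / 2) * s ^ (-((n : ℝ) + 1) / 2)) *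
          (exp (-t ^ 2 / (4 * s)) * exp (-(‖x - y‖ ^ 2 / 32) / s))) := by ring
      _ = K * (s ^ (-((n : ℝ) / 2 + 1) - 1) * exp (-b / s)) := by
          rw [← rpow_add hs', ← exp_add]
          congr 3
          · ring
          · field_simp
            ring
  have hsqrt : 1 ≤ √(4 * π) := one_le_sqrt.2 (by linarith [pi_gt_three])
  unfold Omj
  rw [abs_div, abs_mul, abs_of_pos ht, abs_of_nonneg (by positivity : 0 ≤ t ^ 2 / √(4 * π)),
    div_le_iff₀ ht]
  calc _ ≤ t ^ 2 * (K * (Gamma ((n : ℝ) / 2 + 1) * b ^ (-((n : ℝ) / 2 + 1)))) := by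
        gcongr
        exact div_le_self (sq_nonneg t) hsqrt
    _ = _ := by ring

theorem riesz_kernel_bound (n : ℕ) (hn : 1 ≤ n) (j : Fin n) :
    ∃ C > (0 : ℝ), ∃ c > (0 : ℝ), ∀ x y : EuclideanSpace ℝ (Fin n), x ≠ y →
      IntegrableOn (fun t : ℝ => Omj n j x y t / t) (Set.Ioi (0 : ℝ)) ∧
      |Real.pi ^ (-(1 : ℝ) / 2) * ∫ t in Set.Ioi (0 : ℝ), Omj n j x y t / t| ≤
        C * Real.exp (-c * (‖x - y‖ ^ 2 + ‖y‖ * ‖x - y‖)) / ‖x - y‖ ^ n := by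
  have hn0 : (0 : ℝ) < n := by exact_mod_cast hn
  have hΓ : 0 < Gamma ((n : ℝ) / 2 + 1) := Gamma_pos_of_pos (by positivity)
  refine ⟨4 * Gamma ((n : ℝ) / 2 + 1) * (2 / ((n : ℝ) / 2) * (1 / 32 : ℝ) ^ (-((n : ℝ) / 2))),
    by positivity, 1 / 64, by norm_num, fun x y hxy => ?_⟩
  have hr : 0 < ‖x - y‖ := norm_pos_iff.2 (sub_ne_zero.2 hxy)
  obtain ⟨hint, hval⟩ := integral_mul_sq_add_rpow (half_pos hn0)
    (by positivity : 0 < ‖x - y‖ ^ 2 / 32)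
  have hbound : ∀ᵐ t ∂volume.restrict (Ioi (0 : ℝ)), ‖Omj n j x y t / t‖ ≤
      4 * exp (-(1 / 64) * (‖x - y‖ ^ 2 + ‖y‖ * ‖x - y‖)) * Gamma ((n : ℝ) / 2 + 1) *
        (t * (t ^ 2 / 4 + ‖x - y‖ ^ 2 / 32) ^ (-((n : ℝ) / 2 + 1))) := by
    filter_upwards [ae_restrict_mem measurableSet_Ioi] with t ht
    exact abs_Omj_div_le hn j hxy ht
  refine ⟨(hint.const_mul _).mono' (aestronglyMeasurable_Omj_div n j x y _) hbound, ?_⟩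
  have hI := norm_integral_le_of_norm_le (hint.const_mul _) hbound
  rw [integral_const_mul, hval, Real.norm_eq_abs] at hI
  have hπ : π ^ (-(1 : ℝ) / 2) ≤ 1 :=
    rpow_le_one_of_one_le_of_nonpos (by linarith [pi_gt_three]) (by norm_num)
  have hpow : (‖x - y‖ ^ 2 / 32) ^ (-((n : ℝ) / 2)) =
      (1 / 32 : ℝ) ^ (-((n : ℝ) / 2)) / ‖x - y‖ ^ n := by
    rw [div_eq_mul_one_div, mul_rpow (by positivity) (by norm_num), ← rpow_natCast _ 2,
      ← rpow_mul hr.le, show ((2 : ℕ) : ℝ) * -((n : ℝ) / 2) = -(n : ℝ) by push_cast; ring,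
      rpow_neg hr.le, rpow_natCast, mul_comm, ← div_eq_mul_inv]
  rw [abs_mul, abs_of_pos (by positivity : 0 < π ^ (-(1 : ℝ) / 2))]
  refine (mul_le_of_le_one_left (abs_nonneg _) hπ).trans (hI.trans_eq ?_)
  rw [hpow]
  ring
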